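/- (Klee) Let H be a real Hilbert space and let K be a Chebyshev subset of H that is closed in the weak topology of H. Then K is convex. -/

import Mathlib

open Metric

open Filter Topology

section Asplund

variable {H : Type*} [NormedAddCommGroup H] {K : Set H}

/-- Asplund's function `x ↦ (‖x‖² - d(x, K)²) / 2`. -/
noncomputable def asplund (K : Set H) (x : H) : ℝ := (‖x‖ ^ 2 - infDist x K ^ 2) / 2

theorem continuous_asplund : Continuous (asplund K) := by
  have := continuous_infDist_pt K
  unfold asplund
  fun_prop

variable [InnerProductSpace ℝ H]

theorem le_asplund {y : H} (hy : y ∈ K) (x : H) :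
    inner ℝ x y - ‖y‖ ^ 2 / 2 ≤ asplund K x := by
  have h : infDist x K ^ 2 ≤ ‖x - y‖ ^ 2 :=
    pow_le_pow_left₀ infDist_nonneg (by simpa [dist_eq_norm] using infDist_le_dist_of_mem hy) 2
  rw [norm_sub_sq_real] at h
  unfold asplund
  linarith

theorem asplund_eq {x y : H} (hxy : ‖x - y‖ = infDist x K) :
    asplund K x = inner ℝ x y - ‖y‖ ^ 2 / 2 := by
  rw [asplund, ← hxy, norm_sub_sq_real]
  ring

theorem asplund_midpoint_le {a b y : H} (hy : y ∈ K)
    (hp : ‖midpoint ℝ a b - y‖ = infDist (midpoint ℝ a b) K) :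
    asplund K (midpoint ℝ a b) ≤ (asplund K a + asplund K b) / 2 := by
  rw [asplund_eq hp, midpoint_eq_smul_add, inner_smul_left, inner_add_left]
  have := le_asplund hy a
  have := le_asplund hy b
  simp only [invOf_eq_inv, conj_trivial]
  linarith

theorem norm_midpoint_sq (a b : H) :
    ‖midpoint ℝ a b‖ ^ 2 = (‖a‖ ^ 2 + ‖b‖ ^ 2) / 2 - ‖a - b‖ ^ 2 / 4 := by
  rw [midpoint_eq_smul_add, norm_smul, mul_pow, norm_add_sq_real, norm_sub_sq_real]
  norm_num
  ring

end Asplund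

section Complete

variable {H : Type*} [NormedAddCommGroup H] [InnerProductSpace ℝ H] [CompleteSpace H]

/-- Bounded families in a Hilbert space converge weakly along any ultrafilter. -/
theorem exists_weak_limit_of_bounded {ι : Type*} (U : Ultrafilter ι) (u : ι → H) (R : ℝ)
    (hu : ∀ i, ‖u i‖ ≤ R) :
    ∃ q : H, ∀ h : H, Tendsto (fun i => inner ℝ (u i) h) U (𝓝 (inner ℝ q h)) := by
  have hc := WeakDual.isCompact_closedBall (𝕜 := ℝ) (E := H) 0 R
  let v : ι → WeakDual ℝ H := fun i => StrongDual.toWeakDual (InnerProductSpace.toDual ℝ H (u i))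
  obtain ⟨φ, -, hφ⟩ := hc.ultrafilter_le_nhds (U.map v) (by
    refine le_principal_iff.2 (Ultrafilter.mem_map.2 (Eventually.of_forall fun i => ?_))
    simpa [v] using hu i)
  have hφ' : Tendsto v U (𝓝 φ) := hφ
  refine ⟨(InnerProductSpace.toDual ℝ H).symm (WeakDual.toStrongDual φ), fun h => ?_⟩
  rw [InnerProductSpace.toDual_symm_apply]
  exact ((WeakDual.eval_continuous h).tendsto φ).comp hφ'

theorem mem_of_weak_limit {ι : Type*} {l : Filter ι} [l.NeBot] {K : Set H}
    (hK : IsClosed (toWeakSpace ℝ H '' K : Set (WeakSpace ℝ H))) {u : ι → H} {q : H}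
    (hu : ∀ i, u i ∈ K)
    (hq : ∀ h : H, Tendsto (fun i => inner ℝ (u i) h) l (𝓝 (inner ℝ q h))) : q ∈ K := by
  have ht : Tendsto (fun i => toWeakSpace ℝ H (u i)) l (𝓝 (toWeakSpace ℝ H q)) := by
    refine (WeakBilin.tendsto_iff_forall_eval_tendsto _ (fun x y hxy =>
      ext_inner_left ℝ fun v => DFunLike.congr_fun hxy (InnerProductSpace.toDual ℝ H v))).2
      fun φ => ?_
    have h : Tendsto (fun i => φ (u i)) l (𝓝 (φ q)) := by
      have hφ : ∀ v, inner ℝ v ((InnerProductSpace.toDual ℝ H).symm φ) = φ v := fun v => by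
        rw [real_inner_comm, InnerProductSpace.toDual_symm_apply]
      simpa only [hφ] using hq ((InnerProductSpace.toDual ℝ H).symm φ)
    exact h
  obtain ⟨y, hy, hyq⟩ := hK.mem_of_tendsto ht
    (Eventually.of_forall fun i => Set.mem_image_of_mem _ (hu i))
  rwa [← (toWeakSpace ℝ H).injective hyq]

/-- A continuous, bounded below, uniformly midpoint convex function attains its minimum. -/
theorem exists_forall_le_of_midpoint {g : H → ℝ} (hg : Continuous g)
    (hb : BddBelow (Set.range g)) {c : ℝ} (hc : 0 < c)
    (hm : ∀ a b, g (midpoint ℝ a b) ≤ (g a + g b) / 2 - c * ‖a - b‖ ^ 2) :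
    ∃ x, ∀ y, g x ≤ g y := by
  have hle : ∀ y, ⨅ x, g x ≤ g y := fun y => ciInf_le hb y
  have hex : ∀ n : ℕ, ∃ x, g x < (⨅ x, g x) + 1 / ((n : ℝ) + 1) := fun n =>
    exists_lt_of_ciInf_lt (lt_add_of_pos_right _ (by positivity))
  choose u hu using hex
  have hlim := tendsto_one_div_add_atTop_nhds_zero_nat (𝕜 := ℝ)
  have hcau : CauchySeq u := by
    refine cauchySeq_of_le_tendsto_0' (fun n : ℕ => √(1 / ((n : ℝ) + 1) / c)) (fun n k hnk => ?_) ?_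
    · refine Real.le_sqrt_of_sq_le ?_
      rw [le_div_iff₀ hc, dist_eq_norm]
      have h1 := hm (u n) (u k)
      have h2 := hle (midpoint ℝ (u n) (u k))
      have h3 := Nat.one_div_le_one_div (α := ℝ) hnk
      linarith [hu n, hu k]
    · simpa using (hlim.div_const c).sqrt
  obtain ⟨x, hx⟩ := cauchySeq_tendsto_of_complete hcau
  refine ⟨x, fun y => (le_of_tendsto_of_tendsto' ((hg.tendsto x).comp hx)
    (tendsto_const_nhds.add hlim) fun n => (hu n).le).trans ?_⟩
  simpa using hle y

/-- If `y t` is a nearest point to `x + t • h`, then along some sequence of positive `t` tending to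
zero, `y t` converges weakly to the nearest point to `x`. -/
theorem exists_weak_limit_proj {K : Set H}
    (hK : IsClosed (toWeakSpace ℝ H '' K : Set (WeakSpace ℝ H))) {p : H → H}
    (hpK : ∀ x, p x ∈ K) (hp : ∀ x, ‖x - p x‖ = infDist x K)
    (huniq : ∀ x, ∀ y ∈ K, ‖x - y‖ = infDist x K → y = p x) (x h : H) :
    ∃ (U : Ultrafilter ℕ) (t : ℕ → ℝ), (∀ n, 0 < t n) ∧ Tendsto t U (𝓝 0) ∧
      ∀ k : H, Tendsto (fun n => inner ℝ (p (x + t n • h)) k) U (𝓝 (inner ℝ (p x) k)) := by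
  let t : ℕ → ℝ := fun n => 1 / ((n : ℝ) + 1)
  have ht0 : ∀ n, 0 < t n := fun n => Nat.one_div_pos_of_nat
  have ht1 : ∀ n, t n ≤ 1 := fun n => by
    simpa [t] using Nat.one_div_le_one_div (α := ℝ) (Nat.zero_le n)
  have hclose : ∀ n, ‖x - p (x + t n • h)‖ ≤ infDist x K + 2 * (t n * ‖h‖) := fun n => by
    have hth : ‖t n • h‖ = t n * ‖h‖ := by rw [norm_smul, Real.norm_of_nonneg (ht0 n).le]
    have h1 : infDist (x + t n • h) K ≤ infDist x K + t n * ‖h‖ := by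
      simpa [dist_eq_norm, hth] using infDist_le_infDist_add_dist (s := K) (x := x + t n • h) (y := x)
    have h2 : ‖x - p (x + t n • h)‖ ≤ ‖x + t n • h - p (x + t n • h)‖ + ‖t n • h‖ := by
      simpa [add_sub_right_comm] using norm_sub_le (x + t n • h - p (x + t n • h)) (t n • h)
    linarith [hp (x + t n • h)]
  have htl : Tendsto t (hyperfilter ℕ : Ultrafilter ℕ) (𝓝 0) :=
    (tendsto_one_div_add_atTop_nhds_zero_nat (𝕜 := ℝ)).mono_left Nat.hyperfilter_le_atTop
  obtain ⟨q, hq⟩ := exists_weak_limit_of_bounded (hyperfilter ℕ) (fun n => p (x + t n • h))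
    (‖x‖ + (infDist x K + 2 * ‖h‖)) fun n => by
      have h1 := norm_sub_le x (x - p (x + t n • h))
      rw [sub_sub_cancel] at h1
      nlinarith [hclose n, ht1 n, norm_nonneg h]
  have hqK : q ∈ K := mem_of_weak_limit hK (fun n => hpK _) hq
  have hsq : ‖x - q‖ * ‖x - q‖ ≤ infDist x K * ‖x - q‖ := by
    rw [← real_inner_self_eq_norm_mul_norm]
    have hl : Tendsto (fun n => inner ℝ (x - p (x + t n • h)) (x - q)) (hyperfilter ℕ : Ultrafilter ℕ)
        (𝓝 (inner ℝ (x - q) (x - q))) := by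
      simp only [inner_sub_left _ _ (x - q)]
      exact tendsto_const_nhds.sub (hq (x - q))
    have hr : Tendsto (fun n => (infDist x K + 2 * (t n * ‖h‖)) * ‖x - q‖)
        (hyperfilter ℕ : Ultrafilter ℕ) (𝓝 (infDist x K * ‖x - q‖)) := by
      simpa using (tendsto_const_nhds.add ((htl.mul_const ‖h‖).const_mul 2)).mul_const ‖x - q‖
    exact le_of_tendsto_of_tendsto' hl hr fun n => (real_inner_le_norm _ _).trans
      (mul_le_mul_of_nonneg_right (hclose n) (norm_nonneg _))
  have hle : ‖x - q‖ ≤ infDist x K := by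
    rcases (norm_nonneg (x - q)).eq_or_lt with h0 | h0
    · rw [← h0]; exact infDist_nonneg
    · exact le_of_mul_le_mul_right hsq h0
  have hqp := huniq x q hqK (hle.antisymm (by simpa [dist_eq_norm] using infDist_le_dist_of_mem hqK))
  exact ⟨hyperfilter ℕ, t, ht0, htl, hqp ▸ hq⟩

end Complete

/-- (Klee) A weakly closed Chebyshev subset of a real Hilbert space is convex. -/
theorem chebyshev_weakly_closed_convex
    {H : Type*} [NormedAddCommGroup H] [InnerProductSpace ℝ H] [CompleteSpace H]
    (K : Set H)
    (hcheb : ∀ x : H, ∃! y, y ∈ K ∧ ‖x - y‖ = infDist x K)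
    (hwcl : IsClosed (toWeakSpace ℝ H '' K : Set (WeakSpace ℝ H))) :
    Convex ℝ K := by
  choose p hp huniq using hcheb
  have hpK := fun x => (hp x).1
  have hpd := fun x => (hp x).2
  intro a ha b hb r s hr hs hrs
  set z := r • a + s • b with hz
  -- Minimizing `asplund K - ⟪·, z⟫ + ε/2 ‖·‖²` yields projections arbitrarily close to `z`.
  set C : ℝ := r * (‖a‖ ^ 2 / 2) + s * (‖b‖ ^ 2 / 2)
  have hC : ∀ x, inner ℝ x z - C ≤ asplund K x := fun x => by
    have h1 := mul_le_mul_of_nonneg_left (le_asplund ha x) hr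
    have h2 := mul_le_mul_of_nonneg_left (le_asplund hb x) hs
    have h3 : asplund K x = r * asplund K x + s * asplund K x := by rw [← add_mul, hrs, one_mul]
    rw [hz, inner_add_right, inner_smul_right, inner_smul_right, h3]
    simp only [C]
    linarith
  have hbound : ∀ ε : ℝ, 0 < ε → infDist z K ^ 2 ≤ 2 * C * ε := fun ε hε => by
    let g : H → ℝ := fun x => asplund K x - inner ℝ x z + ε / 2 * ‖x‖ ^ 2
    have hgb : ∀ x, -C + ε / 2 * ‖x‖ ^ 2 ≤ g x := fun x => by
      have := hC x
      simp only [g]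
      linarith
    obtain ⟨x, hx⟩ : ∃ x, ∀ y, g x ≤ g y := by
      refine exists_forall_le_of_midpoint (c := ε / 8) ?_ ⟨-C, ?_⟩ (by positivity) fun u v => ?_
      · have := continuous_asplund (K := K)
        fun_prop
      · rintro _ ⟨x, rfl⟩
        exact (le_add_of_nonneg_right (by positivity)).trans (hgb x)
      · have h1 := asplund_midpoint_le (hpK (midpoint ℝ u v)) (hpd (midpoint ℝ u v))
        have h2 : inner ℝ (midpoint ℝ u v) z = (inner ℝ u z + inner ℝ v z) / 2 := by
          rw [midpoint_eq_smul_add, inner_smul_left, inner_add_left]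
          simp only [invOf_eq_inv, conj_trivial]
          ring
        simp only [g]
        rw [h2, norm_midpoint_sq]
        linarith
    set w := p x - z + ε • x with hw
    obtain ⟨U, t, ht0, ht, hlim⟩ := exists_weak_limit_proj hwcl hpK hpd
      (fun x y hy hxy => huniq x y ⟨hy, hxy⟩) x (-w)
    have hdir : ∀ n, 0 ≤ inner ℝ (p (x + t n • -w)) (-w) - inner ℝ z (-w)
        + ε * inner ℝ x (-w) + ε / 2 * (t n * ‖w‖ ^ 2) := fun n => by
      set y := p (x + t n • -w)
      have h1 := le_asplund (hpK (x + t n • -w)) x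
      have h2 := asplund_eq (hpd (x + t n • -w))
      have h3 := hx (x + t n • -w)
      simp only [g] at h3
      rw [h2, norm_add_sq_real, norm_smul, norm_neg, mul_pow, Real.norm_eq_abs, sq_abs,
        inner_add_left, inner_add_left, inner_smul_left, inner_smul_left, inner_smul_right] at h3
      simp only [conj_trivial] at h3
      rw [real_inner_comm (-w) y, real_inner_comm (-w) z]
      refine nonneg_of_mul_nonneg_right (a := t n) ?_ (ht0 n)
      linarith
    have hlim' := ((hlim (-w)).sub_const (inner ℝ z (-w))).add_const (ε * inner ℝ x (-w)) |>.add
      ((ht.mul_const (‖w‖ ^ 2)).const_mul (ε / 2))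
    have hge := ge_of_tendsto' hlim' hdir
    have hww : inner ℝ (p x) (-w) - inner ℝ z (-w) + ε * inner ℝ x (-w) = -‖w‖ ^ 2 := by
      have h : inner ℝ w w = inner ℝ (p x) w - inner ℝ z w + ε * inner ℝ x w := by
        conv_lhs => arg 2; rw [hw]
        simp only [inner_add_left, inner_sub_left, inner_smul_left, conj_trivial]
      rw [← real_inner_self_eq_norm_sq, h]
      simp only [inner_neg_right]
      ring
    have hw0 : w = 0 := by
      rw [hww] at hge
      have : ‖w‖ ^ 2 = 0 := le_antisymm (by linarith) (by positivity)
      simpa using this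
    have hzp : z - p x = ε • x := by
      rw [hw0] at hw
      rw [← neg_sub, neg_eq_iff_add_eq_zero, ← hw]
    have hd : infDist z K ≤ ‖ε • x‖ := by
      simpa [dist_eq_norm, hzp] using infDist_le_dist_of_mem (x := z) (hpK x)
    have hsq := pow_le_pow_left₀ infDist_nonneg hd 2
    rw [norm_smul, mul_pow, Real.norm_eq_abs, sq_abs] at hsq
    have hg0 : g 0 ≤ 0 := by
      simp only [g, asplund, norm_zero, inner_zero_left]
      nlinarith [sq_nonneg (infDist (0 : H) K)]
    have h4 := (hgb x).trans ((hx 0).trans hg0)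
    nlinarith
  have hdz : infDist z K = 0 := by
    have hl : Tendsto (fun ε : ℝ => 2 * C * ε) (𝓝[>] 0) (𝓝 0) := by
      simpa using ((continuous_const_mul (2 * C)).tendsto 0).mono_left nhdsWithin_le_nhds
    have h := ge_of_tendsto hl (eventually_mem_nhdsWithin.mono hbound)
    exact pow_eq_zero_iff two_ne_zero |>.1 (le_antisymm h (by positivity))
  have := hpd z
  rw [hdz, norm_sub_eq_zero_iff] at this
  exact this ▸ hpK z
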